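/- For every u ∈ L with ‖u‖ = 1, one has ‖E_γ(u) − 1‖ = p^(−1/(p−1)); that is, if K′ is a p-adic field containing γ and u then E_γ(u) − 1 is a uniformising parameter of K′. -/

import Mathlib

/-- The `n`-th coefficient `e n` of Dwork's exponential power series
`E_γ(X) = exp(γ X − γ X^p) = Σ_{n ≥ 0} e_n X^n`, the formal power series obtained by
substituting the constant-term-zero series `γ X − γ X^p` into
`exp(X) = Σ_{n ≥ 0} X^n / n!`.  Expanding `exp(γ X) · exp(−γ X^p)` gives the explicit
convolution formula `e_n = Σ_{i + p·j = n} (γ^i / i!) · ((−γ)^j / j!)`. -/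
noncomputable def dworkCoeff (L : Type*) [Field L] (p : ℕ) (γ : L) (n : ℕ) : L :=
  ∑ j ∈ Finset.range (n / p + 1),
    (γ ^ (n - p * j) / ((n - p * j).factorial : L)) * ((-γ) ^ j / (j.factorial : L))


open PowerSeries in
/-- The power series `exp (c * X ^ m)`. -/
noncomputable def expMonomial {K : Type*} [Field K] (m : ℕ) (c : K) : K⟦X⟧ :=
  .mk fun n => if m ∣ n then c ^ (n / m) / ((n / m).factorial : K) else 0

section expMonomial

open PowerSeries

variable {K : Type*} [Field K]

theorem coeff_expMonomial (m : ℕ) (c : K) (n : ℕ) :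
    coeff n (expMonomial m c) =
      if m ∣ n then c ^ (n / m) / ((n / m).factorial : K) else 0 := by
  simp [expMonomial]

theorem constantCoeff_expMonomial (m : ℕ) (c : K) : constantCoeff (expMonomial m c) = 1 := by
  rw [← coeff_zero_eq_constantCoeff_apply, coeff_expMonomial]
  simp

theorem expMonomial_eq_expand [CharZero K] {m : ℕ} (hm : m ≠ 0) (c : K) :
    expMonomial m c = expand m hm (rescale c (exp K)) := by
  ext n
  rw [coeff_expMonomial, coeff_expand]
  simp [coeff_rescale, coeff_exp, div_eq_mul_inv]

theorem expMonomial_mul [CharZero K] {m : ℕ} (hm : m ≠ 0) (c d : K) :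
    expMonomial m c * expMonomial m d = expMonomial m (c + d) := by
  simp only [expMonomial_eq_expand hm, ← map_mul, exp_mul_exp_eq_exp_add]

theorem expMonomial_zero {m : ℕ} (hm : m ≠ 0) : expMonomial m (0 : K) = 1 := by
  ext n
  rw [coeff_expMonomial, coeff_one]
  by_cases h : m ∣ n
  · obtain ⟨k, rfl⟩ := h
    rcases eq_or_ne k 0 with rfl | hk
    · simp
    · simp [hm, hk, Nat.mul_div_cancel_left k (Nat.pos_of_ne_zero hm)]
  · rw [if_neg h, if_neg]
    rintro rfl
    exact h (dvd_zero m)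

theorem expMonomial_pow [CharZero K] {m : ℕ} (hm : m ≠ 0) (c : K) (k : ℕ) :
    expMonomial m c ^ k = expMonomial m (k * c) := by
  induction k with
  | zero => simp [expMonomial_zero hm]
  | succ k ih => rw [pow_succ, ih, expMonomial_mul hm]; congr 1; push_cast; ring

theorem expand_expMonomial [CharZero K] {m q : ℕ} (hm : m ≠ 0) (hq : q ≠ 0) (c : K) :
    expand q hq (expMonomial m c) = expMonomial (q * m) c := by
  rw [expMonomial_eq_expand hm, expMonomial_eq_expand (mul_ne_zero hq hm), expand_mul]

theorem rescale_expMonomial {m : ℕ} (hm : m ≠ 0) (a c : K) :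
    rescale a (expMonomial m c) = expMonomial m (a ^ m * c) := by
  ext n
  rw [coeff_rescale, coeff_expMonomial, coeff_expMonomial]
  by_cases h : m ∣ n
  · obtain ⟨k, rfl⟩ := h
    simp only [dvd_mul_right, if_true, Nat.mul_div_cancel_left k (Nat.pos_of_ne_zero hm)]
    rw [mul_pow, pow_mul, mul_div_assoc]
  · simp [h]

theorem map_expMonomial {K' : Type*} [Field K'] (f : K →+* K') (m : ℕ) (c : K) :
    PowerSeries.map f (expMonomial m c) = expMonomial m (f c) := by
  ext n
  rw [coeff_map, coeff_expMonomial, coeff_expMonomial]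
  split_ifs <;> simp

end expMonomial

section padic

variable {p : ℕ} [hp : Fact p.Prime]

open Polynomial in
/-- A polynomial over `ℤ_[p]` satisfies `f ^ p ≡ f(X ^ p)` modulo `p`. -/
theorem PadicInt.norm_coeff_pow_sub_expand_le (f : ℤ_[p][X]) (n : ℕ) :
    ‖(f ^ p - expand ℤ_[p] p f).coeff n‖ ≤ (p : ℝ)⁻¹ := by
  have h : (f ^ p - expand ℤ_[p] p f).map (PadicInt.toZMod (p := p)) = 0 := by
    rw [Polynomial.map_sub, Polynomial.map_pow, Polynomial.map_expand, ZMod.expand_card, sub_self]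
  have h2 := congrArg (fun g => g.coeff n) h
  simp only [Polynomial.coeff_map, Polynomial.coeff_zero] at h2
  have h3 : (f ^ p - expand ℤ_[p] p f).coeff n ∈ RingHom.ker (PadicInt.toZMod (p := p)) := h2
  rw [PadicInt.ker_toZMod, PadicInt.maximalIdeal_eq_span_p] at h3
  have := (PadicInt.norm_le_pow_iff_mem_span_pow ((f ^ p - expand ℤ_[p] p f).coeff n) 1).2
    (by simpa using h3)
  simpa using this

open PowerSeries in
/-- Dwork's integrality criterion, in a truncated form: if `F(X) ^ p` and `G(X) * F(X ^ p)` agree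
below degree `N`, where `G ≡ 1` modulo `p`, then `F` has integral coefficients below degree `N`. -/
theorem Padic.norm_coeff_le_one_of_pow_eq_mul_expand {F G : ℚ_[p]⟦X⟧} {N : ℕ}
    (hF : constantCoeff F = 1) (hG : constantCoeff G = 1)
    (hG' : ∀ n, n ≠ 0 → ‖coeff n G‖ ≤ (p : ℝ)⁻¹)
    (h : ∀ n < N, coeff n (F ^ p) = coeff n (G * expand p hp.out.ne_zero F)) :
    ∀ n < N, ‖coeff n F‖ ≤ 1 := by
  intro n
  induction n using Nat.strong_induction_on with
  | _ n ih =>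
  intro hn
  rcases eq_or_ne n 0 with rfl | hn0
  · simp [hF]
  have hp0 : (0 : ℝ) < p := by exact_mod_cast hp.out.pos
  have hint : ∀ i < n, ‖coeff i F‖ ≤ 1 := fun i hi => ih i hi (hi.trans hn)
  have hex : ∀ i, ∃ x : ℤ_[p], i < n → (x : ℚ_[p]) = coeff i F := fun i => by
    by_cases hi : i < n
    · exact ⟨⟨coeff i F, hint i hi⟩, fun _ => rfl⟩
    · exact ⟨0, fun h => absurd h hi⟩
  choose b hb using hex
  have hbc : ∀ i < n, ((coeff i (.mk b : ℤ_[p]⟦X⟧) : ℤ_[p]) : ℚ_[p]) = coeff i F := by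
    intro i hi
    rw [coeff_mk, hb i hi]
  set f := trunc n (.mk b : ℤ_[p]⟦X⟧) with hf
  set φ := PadicInt.Coe.ringHom (p := p) with hφ
  set g : ℚ_[p]⟦X⟧ := ((f.map φ : Polynomial ℚ_[p]) : ℚ_[p]⟦X⟧) with hg
  have hgc : ∀ i, coeff i g = if i < n then coeff i F else 0 := by
    intro i
    rw [hg, Polynomial.coeff_coe, Polynomial.coeff_map, hf, coeff_trunc]
    split_ifs with hi
    · exact hbc i hi
    · simp
  have hFg : F = g + X ^ n * .mk fun k => coeff (n + k) F := by
    ext i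
    rw [map_add, hgc, coeff_X_pow_mul']
    by_cases hi : i < n
    · simp [hi, not_le.2 hi]
    · simp [hi, not_lt.1 hi]
  set R : ℚ_[p]⟦X⟧ := .mk fun k => coeff (n + k) F with hR
  have hg0 : constantCoeff g = 1 := by
    rw [← coeff_zero_eq_constantCoeff_apply, hgc, if_pos (Nat.pos_of_ne_zero hn0),
      coeff_zero_eq_constantCoeff_apply, hF]
  have hR0 : constantCoeff R = coeff n F := by
    rw [← coeff_zero_eq_constantCoeff_apply, hR, coeff_mk, add_zero]
  have key1 : coeff n (F ^ p) = coeff n (g ^ p) + p * coeff n F := by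
    obtain ⟨k, hk⟩ := Polynomial.powAddExpansion g (X ^ n * R) p
    rw [hFg, hk, map_add, map_add, ← hFg]
    have e1 : (p : ℚ_[p]⟦X⟧) * g ^ (p - 1) * (X ^ n * R) =
      X ^ n * (C (p : ℚ_[p]) * g ^ (p - 1) * R) := by
      rw [map_natCast]; ring
    have e2 : k * (X ^ n * R) ^ 2 = X ^ (n + n) * (k * R ^ 2) := by ring
    rw [e1, e2, coeff_X_pow_mul', coeff_X_pow_mul', if_pos le_rfl, if_neg (by omega), Nat.sub_self]
    simp [hg0, hR0]
  have key2 : ‖coeff n (g ^ p) - coeff n (expand p hp.out.ne_zero F)‖ ≤ (p : ℝ)⁻¹ := by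
    have := PadicInt.norm_coeff_pow_sub_expand_le f n
    convert this using 1
    rw [PadicInt.norm_def]
    congr 1
    rw [Polynomial.coeff_sub, PadicInt.coe_sub]
    congr 1
    · rw [hg, ← Polynomial.coe_pow, ← Polynomial.map_pow, Polynomial.coeff_coe,
        Polynomial.coeff_map]
      rfl
    · rw [coeff_expand, Polynomial.coeff_expand hp.out.pos]
      split_ifs
      · have hlt := Nat.div_lt_self (Nat.pos_of_ne_zero hn0) hp.out.one_lt
        rw [hf, coeff_trunc, if_pos hlt, hbc _ hlt]
      · simp
  have key3 : ‖coeff n ((G - 1) * expand p hp.out.ne_zero F)‖ ≤ (p : ℝ)⁻¹ := by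
    rw [coeff_mul]
    refine IsUltrametricDist.norm_sum_le_of_forall_le_of_nonneg (by positivity) ?_
    rintro ⟨i, j⟩ hij
    have hij' : i + j = n := by simpa using hij
    rw [norm_mul, ← mul_one (p : ℝ)⁻¹]
    refine mul_le_mul ?_ ?_ (norm_nonneg _) (by positivity)
    · rw [map_sub, coeff_one]
      split_ifs with hi
      · dsimp only at hi
        simp [hi, hG]
      · simpa using hG' i hi
    · dsimp only
      rw [coeff_expand]
      split_ifs
      · refine hint _ ?_
        rcases eq_or_ne j 0 with rfl | hj
        · simpa using Nat.pos_of_ne_zero hn0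
        · exact (Nat.div_lt_self (Nat.pos_of_ne_zero hj) hp.out.one_lt).trans_le (by omega)
      · simp
  have key4 : (p : ℚ_[p]) * coeff n F = coeff n ((G - 1) * expand p hp.out.ne_zero F) -
      (coeff n (g ^ p) - coeff n (expand p hp.out.ne_zero F)) := by
    have := h n hn
    rw [key1] at this
    rw [sub_mul, one_mul, map_sub, ← this]
    ring
  have key5 : ‖(p : ℚ_[p]) * coeff n F‖ ≤ (p : ℝ)⁻¹ := by
    rw [key4, sub_eq_add_neg]
    exact (IsUltrametricDist.norm_add_le_max _ _).trans (max_le key3 (by rwa [norm_neg]))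
  rw [norm_mul, Padic.norm_p] at key5
  exact le_of_mul_le_mul_left (by simpa using key5) (inv_pos.2 hp0)

/-- The coefficients of `exp (p * X) - 1` are divisible by `p`. -/
theorem Padic.norm_pow_div_factorial_le {n : ℕ} (hn : n ≠ 0) :
    ‖(p : ℚ_[p]) ^ n / (n.factorial : ℚ_[p])‖ ≤ (p : ℝ)⁻¹ := by
  have h := padicValNat_factorial_lt_of_ne_zero p hn
  have hp1 : (1 : ℝ) < p := by exact_mod_cast hp.out.one_lt
  rw [norm_div, norm_pow, Padic.norm_p,
    Padic.norm_eq_zpow_neg_valuation (by exact_mod_cast n.factorial_ne_zero),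
    Padic.valuation_natCast, inv_pow, ← zpow_natCast, ← zpow_neg, ← zpow_sub₀ (by positivity),
    ← zpow_neg_one]
  exact zpow_le_zpow_right₀ hp1.le (by omega)

open PowerSeries in
/-- The truncated Artin-Hasse exponential `exp (X + X ^ p / p + ⋯ + X ^ (p ^ k) / p ^ k)` has
integral coefficients below degree `p ^ (k + 1)`. -/
theorem Padic.norm_coeff_prod_expMonomial_le_one (k n : ℕ) (hn : n < p ^ (k + 1)) :
    ‖coeff n (∏ i ∈ Finset.range (k + 1),
      expMonomial (p ^ i) (((p : ℚ_[p]) ^ i)⁻¹))‖ ≤ 1 := by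
  have hp0 : (p : ℚ_[p]) ≠ 0 := by exact_mod_cast hp.out.ne_zero
  have hpi (i : ℕ) : p ^ i ≠ 0 := pow_ne_zero _ hp.out.ne_zero
  set F : ℚ_[p]⟦X⟧ := ∏ i ∈ Finset.range (k + 1), expMonomial (p ^ i) (((p : ℚ_[p]) ^ i)⁻¹)
    with hF
  have hfun : F ^ p * expMonomial (p ^ (k + 1)) (p * ((p : ℚ_[p]) ^ (k + 1))⁻¹) =
      expMonomial 1 (p : ℚ_[p]) * expand p hp.out.ne_zero F := by
    have h1 : F ^ p = ∏ i ∈ Finset.range (k + 1),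
        expMonomial (p ^ i) (p * ((p : ℚ_[p]) ^ i)⁻¹) := by
      rw [hF, ← Finset.prod_pow]
      exact Finset.prod_congr rfl fun i _ => expMonomial_pow (hpi i) _ _
    have h2 : expand p hp.out.ne_zero F = ∏ i ∈ Finset.range (k + 1),
        expMonomial (p ^ (i + 1)) (p * ((p : ℚ_[p]) ^ (i + 1))⁻¹) := by
      rw [hF, map_prod]
      refine Finset.prod_congr rfl fun i _ => ?_
      rw [expand_expMonomial (hpi i), pow_succ' p i]
      congr 1
      field_simp
      rw [pow_succ]
    rw [h1, h2, ← Finset.prod_range_succ (fun i => expMonomial (p ^ i) (p * ((p : ℚ_[p]) ^ i)⁻¹)),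
      Finset.prod_range_succ']
    simp [mul_comm]
  refine Padic.norm_coeff_le_one_of_pow_eq_mul_expand (G := expMonomial 1 (p : ℚ_[p]))
    (N := p ^ (k + 1)) ?_ (constantCoeff_expMonomial _ _) ?_ ?_ n hn
  · rw [hF, map_prod]
    exact Finset.prod_eq_one fun i _ => constantCoeff_expMonomial _ _
  · intro m hm
    rw [coeff_expMonomial]
    simpa using Padic.norm_pow_div_factorial_le (p := p) hm
  · intro m hm
    rw [← hfun, coeff_mul, Finset.sum_eq_single (m, 0)]
    · simp [constantCoeff_expMonomial]
    · rintro ⟨i, j⟩ hij hne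
      have hij' : i + j = m := by simpa using hij
      have hj : j ≠ 0 := by
        rintro rfl
        exact hne (by simp [← hij'])
      rw [coeff_expMonomial, if_neg, mul_zero]
      exact fun hd => absurd (Nat.le_of_dvd (Nat.pos_of_ne_zero hj) hd) (by omega)
    · simp

end padic

section dwork

open PowerSeries

theorem PowerSeries.norm_coeff_mul_le_pow {K : Type*} [NormedField K] [IsUltrametricDist K]
    {f g : K⟦X⟧} {r : ℝ} (hr : 0 ≤ r) {n : ℕ} (hf : ∀ m ≤ n, ‖coeff m f‖ ≤ r ^ m)
    (hg : ∀ m ≤ n, ‖coeff m g‖ ≤ r ^ m) : ∀ m ≤ n, ‖coeff m (f * g)‖ ≤ r ^ m := by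
  intro m hm
  rw [coeff_mul]
  refine IsUltrametricDist.norm_sum_le_of_forall_le_of_nonneg (by positivity) ?_
  rintro ⟨i, j⟩ hij
  have hij' : i + j = m := by simpa using hij
  rw [norm_mul, ← hij', pow_add]
  exact mul_le_mul (hf i (by omega)) (hg j (by omega)) (norm_nonneg _) (by positivity)

theorem PowerSeries.norm_coeff_prod_le_pow {K ι : Type*} [NormedField K] [IsUltrametricDist K]
    {s : Finset ι} {f : ι → K⟦X⟧} {r : ℝ} (hr : 0 ≤ r) {n : ℕ}
    (hf : ∀ i ∈ s, ∀ m ≤ n, ‖coeff m (f i)‖ ≤ r ^ m) :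
    ∀ m ≤ n, ‖coeff m (∏ i ∈ s, f i)‖ ≤ r ^ m := by
  classical
  induction s using Finset.induction_on with
  | empty =>
    intro m _
    rw [Finset.prod_empty, coeff_one]
    split_ifs with h
    · simp [h]
    · simpa using pow_nonneg hr m
  | insert a s ha ih =>
    rw [Finset.prod_insert ha]
    exact norm_coeff_mul_le_pow hr (hf a (Finset.mem_insert_self a s))
      (ih fun i hi => hf i (Finset.mem_insert_of_mem hi))

theorem dworkCoeff_eq_coeff {L : Type*} [Field L] {p : ℕ} (hp : p ≠ 0) (γ : L) (n : ℕ) :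
    dworkCoeff L p γ n = coeff n (expMonomial 1 γ * expMonomial p (-γ)) := by
  rw [mul_comm, coeff_mul, Finset.Nat.sum_antidiagonal_eq_sum_range_succ_mk, dworkCoeff]
  refine Finset.sum_of_injOn (fun j => p * j) ?_ ?_ ?_ ?_
  · exact fun a _ b _ h => Nat.eq_of_mul_eq_mul_left (Nat.pos_of_ne_zero hp) h
  · intro j hj
    have : j ≤ n / p := by simpa [Nat.lt_succ_iff] using hj
    have := (Nat.le_div_iff_mul_le (Nat.pos_of_ne_zero hp)).1 this
    simp only [Finset.coe_range, Set.mem_Iio]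
    rw [mul_comm]
    omega
  · intro k hk hk'
    dsimp only
    rw [coeff_expMonomial, if_neg, zero_mul]
    rintro ⟨j, rfl⟩
    refine hk' ⟨j, ?_, rfl⟩
    have : p * j ≤ n := by simpa [Nat.lt_succ_iff] using hk
    have : j ≤ n / p := (Nat.le_div_iff_mul_le (Nat.pos_of_ne_zero hp)).2 (by rwa [mul_comm])
    simpa [Nat.lt_succ_iff] using this
  · intro j _
    simp only [coeff_expMonomial, dvd_mul_right, one_dvd, if_true, Nat.div_one,
      Nat.mul_div_cancel_left j (Nat.pos_of_ne_zero hp)]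
    ring

theorem dworkCoeff_zero {L : Type*} [Field L] (p : ℕ) (γ : L) : dworkCoeff L p γ 0 = 1 := by
  simp [dworkCoeff]

theorem dworkCoeff_of_lt {L : Type*} [Field L] {p : ℕ} (γ : L) {n : ℕ} (hn : n < p) :
    dworkCoeff L p γ n = γ ^ n / (n.factorial : L) := by
  simp [dworkCoeff, Nat.div_eq_of_lt hn]

variable {p : ℕ} [hp : Fact p.Prime] {L : Type*} [NormedField L] [Algebra ℚ_[p] L]

theorem norm_natCast_of_norm_algebraMap (hnorm : ∀ q : ℚ_[p], ‖algebraMap ℚ_[p] L q‖ = ‖q‖)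
    (n : ℕ) : ‖(n : L)‖ = ‖(n : ℚ_[p])‖ := by
  rw [← hnorm, map_natCast]

theorem isUltrametricDist_of_norm_algebraMap
    (hnorm : ∀ q : ℚ_[p], ‖algebraMap ℚ_[p] L q‖ = ‖q‖) : IsUltrametricDist L :=
  IsUltrametricDist.isUltrametricDist_of_forall_norm_natCast_le_one fun n => by
    rw [norm_natCast_of_norm_algebraMap hnorm]
    exact IsUltrametricDist.norm_natCast_le_one ℚ_[p] n

variable {γ : L}

theorem norm_pow_of_pow_eq_neg_prime (hnorm : ∀ q : ℚ_[p], ‖algebraMap ℚ_[p] L q‖ = ‖q‖)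
    (hγ : γ ^ (p - 1) = -(p : L)) : ‖γ‖ ^ (p - 1) = (p : ℝ)⁻¹ := by
  rw [← norm_pow, hγ, norm_neg, norm_natCast_of_norm_algebraMap hnorm, Padic.norm_p]

theorem norm_pos_of_pow_eq_neg_prime (hnorm : ∀ q : ℚ_[p], ‖algebraMap ℚ_[p] L q‖ = ‖q‖)
    (hγ : γ ^ (p - 1) = -(p : L)) : 0 < ‖γ‖ := by
  refine (norm_nonneg γ).lt_of_ne fun h => ?_
  have h1 := norm_pow_of_pow_eq_neg_prime hnorm hγ
  rw [← h, zero_pow (Nat.sub_ne_zero_of_lt hp.out.one_lt)] at h1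
  exact inv_ne_zero (by exact_mod_cast hp.out.ne_zero) h1.symm

theorem norm_lt_one_of_pow_eq_neg_prime (hnorm : ∀ q : ℚ_[p], ‖algebraMap ℚ_[p] L q‖ = ‖q‖)
    (hγ : γ ^ (p - 1) = -(p : L)) : ‖γ‖ < 1 := by
  refine (pow_lt_one_iff_of_nonneg (norm_nonneg _) (Nat.sub_ne_zero_of_lt hp.out.one_lt)).1 ?_
  rw [norm_pow_of_pow_eq_neg_prime hnorm hγ]
  exact inv_lt_one_of_one_lt₀ (by exact_mod_cast hp.out.one_lt)

theorem norm_eq_rpow_of_pow_eq_neg_prime (hnorm : ∀ q : ℚ_[p], ‖algebraMap ℚ_[p] L q‖ = ‖q‖)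
    (hγ : γ ^ (p - 1) = -(p : L)) : ‖γ‖ = (p : ℝ) ^ (-(1 : ℝ) / ((p : ℝ) - 1)) := by
  rw [← Real.pow_rpow_inv_natCast (norm_nonneg γ) (Nat.sub_ne_zero_of_lt hp.out.one_lt),
    norm_pow_of_pow_eq_neg_prime hnorm hγ, ← Real.rpow_neg_one, ← Real.rpow_mul (by positivity),
    Nat.cast_sub hp.out.one_lt.le]
  simp [div_eq_mul_inv]

theorem norm_pow_le_norm_factorial (hnorm : ∀ q : ℚ_[p], ‖algebraMap ℚ_[p] L q‖ = ‖q‖)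
    (hγ : γ ^ (p - 1) = -(p : L)) (n : ℕ) : ‖γ‖ ^ n ≤ ‖(n.factorial : L)‖ := by
  rw [norm_natCast_of_norm_algebraMap hnorm,
    Padic.norm_eq_zpow_neg_valuation (by exact_mod_cast n.factorial_ne_zero),
    Padic.valuation_natCast, zpow_neg, zpow_natCast, ← inv_pow,
    ← norm_pow_of_pow_eq_neg_prime hnorm hγ, ← pow_mul]
  refine pow_le_pow_of_le_one (norm_nonneg _) (norm_lt_one_of_pow_eq_neg_prime hnorm hγ).le ?_
  rw [sub_one_mul_padicValNat_factorial]
  exact Nat.sub_le _ _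

theorem norm_coeff_expMonomial_le (hnorm : ∀ q : ℚ_[p], ‖algebraMap ℚ_[p] L q‖ = ‖q‖)
    (hγ : γ ^ (p - 1) = -(p : L)) {r : ℝ} (hr : 0 ≤ r) {m : ℕ} {c : L}
    (hc : ‖c‖ ≤ ‖γ‖ * r ^ m) (n : ℕ) : ‖coeff n (expMonomial m c)‖ ≤ r ^ n := by
  have hγ0 := norm_pos_of_pow_eq_neg_prime hnorm hγ
  rw [coeff_expMonomial]
  split_ifs with h
  · rw [norm_div, norm_pow, div_le_iff₀
      ((pow_pos hγ0 _).trans_le (norm_pow_le_norm_factorial hnorm hγ _))]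
    calc ‖c‖ ^ (n / m) ≤ (‖γ‖ * r ^ m) ^ (n / m) := by gcongr
      _ = r ^ n * ‖γ‖ ^ (n / m) := by
        rw [mul_pow, ← pow_mul, Nat.mul_div_cancel' h, mul_comm]
      _ ≤ _ := by
        gcongr
        exact norm_pow_le_norm_factorial hnorm hγ _
  · simpa using pow_nonneg hr n

theorem one_add_sq_mul_pow_add_le_pow (q k : ℕ) :
    1 + q ^ 2 * (q + 1) ^ k + q * (k + 2) ≤ (q + 1) ^ (k + 2) := by
  have h : 1 + k * q ≤ (q + 1) ^ k := by
    have := one_add_mul_le_pow (a := (q : ℤ)) (by omega) k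
    rw [add_comm q 1]
    exact_mod_cast this
  have h2 : (q + 1) ^ (k + 2) = q ^ 2 * (q + 1) ^ k + (2 * q + 1) * (q + 1) ^ k := by ring
  nlinarith [Nat.zero_le (k * q * q), Nat.mul_le_mul_left (2 * q + 1) h]

theorem norm_pow_div_prime_pow_le (hnorm : ∀ q : ℚ_[p], ‖algebraMap ℚ_[p] L q‖ = ‖q‖)
    (hγ : γ ^ (p - 1) = -(p : L)) {r : ℝ} (hr : r ^ (p ^ 2) = ‖γ‖ ^ ((p - 1) ^ 2)) (k : ℕ) :
    ‖γ ^ p ^ (k + 2) * ((p : L) ^ (k + 2))⁻¹‖ ≤ ‖γ‖ * r ^ (p ^ (k + 2)) := by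
  have hγ0 := norm_pos_of_pow_eq_neg_prime hnorm hγ
  have hpn : ‖(p : L)‖ = ‖γ‖ ^ (p - 1) := by rw [← norm_pow, hγ, norm_neg]
  have hr2 : r ^ (p ^ (k + 2)) = ‖γ‖ ^ ((p - 1) ^ 2 * p ^ k) := by
    rw [add_comm k 2, pow_add, pow_mul, hr, pow_mul]
  rw [norm_mul, norm_inv, norm_pow, norm_pow, hpn, hr2, ← div_eq_mul_inv,
    div_le_iff₀ (by positivity), ← pow_mul, ← pow_succ', ← pow_add]
  refine pow_le_pow_of_le_one (norm_nonneg _) (norm_lt_one_of_pow_eq_neg_prime hnorm hγ).le ?_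
  have := one_add_sq_mul_pow_add_le_pow (p - 1) k
  rw [Nat.sub_add_cancel hp.out.one_lt.le] at this
  omega

/-- Dwork's estimate `‖e_n‖ ≤ p ^ (-n (p - 1) / p ^ 2)`. -/
theorem norm_dworkCoeff_le (hnorm : ∀ q : ℚ_[p], ‖algebraMap ℚ_[p] L q‖ = ‖q‖)
    (hγ : γ ^ (p - 1) = -(p : L)) {r : ℝ} (hγr : ‖γ‖ ≤ r)
    (hr : r ^ (p ^ 2) = ‖γ‖ ^ ((p - 1) ^ 2)) (n : ℕ) : ‖dworkCoeff L p γ n‖ ≤ r ^ n := by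
  have := isUltrametricDist_of_norm_algebraMap hnorm
  have : CharZero L := charZero_of_injective_algebraMap (algebraMap ℚ_[p] L).injective
  have hr0 : 0 ≤ r := (norm_nonneg γ).trans hγr
  have hpL : (p : L) ≠ 0 := by exact_mod_cast hp.out.ne_zero
  have hpi (i : ℕ) : p ^ i ≠ 0 := pow_ne_zero _ hp.out.ne_zero
  set F : ℚ_[p]⟦X⟧ := ∏ i ∈ Finset.range (n + 1 + 1), expMonomial (p ^ i) (((p : ℚ_[p]) ^ i)⁻¹)
    with hF
  set c : ℕ → L := fun i => γ ^ p ^ i * ((p : L) ^ i)⁻¹ with hc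
  have hc1 : c 1 = -γ := by
    have : γ ^ p = -(p : L) * γ := by
      rw [← hγ, ← pow_succ, Nat.sub_add_cancel hp.out.one_lt.le]
    simp only [hc, pow_one, this]
    field_simp
  have hmap : rescale γ (F.map (algebraMap ℚ_[p] L)) =
      (∏ i ∈ Finset.range n, expMonomial (p ^ (i + 2)) (c (i + 2))) *
        (expMonomial 1 γ * expMonomial p (-γ)) := by
    have h1 : rescale γ (F.map (algebraMap ℚ_[p] L)) =
        ∏ i ∈ Finset.range (n + 1 + 1), expMonomial (p ^ i) (c i) := by
      rw [hF, map_prod, map_prod]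
      refine Finset.prod_congr rfl fun i _ => ?_
      rw [map_expMonomial, rescale_expMonomial (hpi i)]
      simp [hc]
    have hc0 : c 0 = γ := by simp [hc]
    rw [h1, Finset.prod_range_succ', Finset.prod_range_succ', zero_add, hc1, hc0, pow_one,
      pow_zero, mul_assoc, mul_comm (expMonomial p _)]
  have hE : expMonomial 1 γ * expMonomial p (-γ) =
      rescale γ (F.map (algebraMap ℚ_[p] L)) *
        ∏ i ∈ Finset.range n, expMonomial (p ^ (i + 2)) (-c (i + 2)) := by
    have h1 : (∏ i ∈ Finset.range n, expMonomial (p ^ (i + 2)) (c (i + 2))) *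
        ∏ i ∈ Finset.range n, expMonomial (p ^ (i + 2)) (-c (i + 2)) = 1 := by
      rw [← Finset.prod_mul_distrib]
      refine Finset.prod_eq_one fun i _ => ?_
      rw [expMonomial_mul (hpi _), add_neg_cancel, expMonomial_zero (hpi _)]
    rw [hmap, mul_right_comm, h1, one_mul]
  rw [dworkCoeff_eq_coeff hp.out.ne_zero, hE]
  refine norm_coeff_mul_le_pow hr0 (n := n) ?_ (norm_coeff_prod_le_pow hr0 ?_) n le_rfl
  · intro m hm
    rw [coeff_rescale, coeff_map, norm_mul, norm_pow, hnorm]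
    have hlt : m < p ^ (n + 1 + 1) :=
      hm.trans_lt ((Nat.lt_pow_self hp.out.one_lt).trans
        (Nat.pow_lt_pow_right hp.out.one_lt (by omega)))
    calc ‖γ‖ ^ m * ‖coeff m F‖ ≤ ‖γ‖ ^ m * 1 := by
          gcongr
          exact Padic.norm_coeff_prod_expMonomial_le_one (n + 1) m hlt
      _ ≤ r ^ m := by rw [mul_one]; gcongr
  · intro i _ m _
    refine norm_coeff_expMonomial_le hnorm hγ hr0 ?_ m
    rw [norm_neg]
    exact norm_pow_div_prime_pow_le hnorm hγ hr i

theorem norm_dworkCoeff_of_lt (hnorm : ∀ q : ℚ_[p], ‖algebraMap ℚ_[p] L q‖ = ‖q‖)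
    {n : ℕ} (hn : n < p) : ‖dworkCoeff L p γ n‖ = ‖γ‖ ^ n := by
  have h : ‖(n.factorial : ℚ_[p])‖ = 1 := by
    rw [Padic.norm_natCast_eq_one_iff]
    exact hp.out.coprime_factorial_of_lt hn
  rw [dworkCoeff_of_lt γ hn, norm_div, norm_pow, norm_natCast_of_norm_algebraMap hnorm, h, div_one]

theorem pow_lt_norm_of_sq_lt {r ρ : ℝ} (hρ0 : 0 < ρ) (hρ1 : ρ < 1) (hr : 0 ≤ r)
    (hrρ : r ^ (p ^ 2) = ρ ^ ((p - 1) ^ 2)) {n : ℕ} (hn : p ^ 2 < (p - 1) ^ 2 * n) :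
    r ^ n < ρ := by
  refine (pow_lt_pow_iff_left₀ (pow_nonneg hr n) hρ0.le (n := p ^ 2)
    (pow_ne_zero 2 hp.out.ne_zero)).1 ?_
  rw [← pow_mul, mul_comm n, pow_mul, hrρ, ← pow_mul]
  exact pow_lt_pow_right_of_lt_one₀ hρ0 hρ1 hn

theorem norm_dworkCoeff_lt_of_lt_five (hnorm : ∀ q : ℚ_[p], ‖algebraMap ℚ_[p] L q‖ = ‖q‖)
    (hγ : γ ^ (p - 1) = -(p : L)) {r : ℝ} (hγr : ‖γ‖ ≤ r) (hr1 : r < 1)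
    (hr : r ^ (p ^ 2) = ‖γ‖ ^ ((p - 1) ^ 2)) {n : ℕ} (hn2 : 2 ≤ n) (hn5 : n < 5) :
    ‖dworkCoeff L p γ n‖ < ‖γ‖ := by
  have hγ0 := norm_pos_of_pow_eq_neg_prime hnorm hγ
  have hγ1 := norm_lt_one_of_pow_eq_neg_prime hnorm hγ
  have hr0 : 0 ≤ r := hγ0.le.trans hγr
  rcases eq_or_ne p 2 with rfl | hp2
  · have hγ2 : γ = -2 := by simpa using hγ
    have n2 : ‖(2 : L)‖ = 2⁻¹ := by
      have h := norm_natCast_of_norm_algebraMap hnorm 2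
      rw [Padic.norm_p] at h
      exact_mod_cast h
    have n3 : ‖(3 : L)‖ = 1 := by
      have h := norm_natCast_of_norm_algebraMap hnorm 3
      rw [Padic.norm_natCast_eq_one_iff.2 (by norm_num)] at h
      exact_mod_cast h
    have n5 : ‖(5 : L)‖ = 1 := by
      have h := norm_natCast_of_norm_algebraMap hnorm 5
      rw [Padic.norm_natCast_eq_one_iff.2 (by norm_num)] at h
      exact_mod_cast h
    have : CharZero L := charZero_of_injective_algebraMap (algebraMap ℚ_[2] L).injective
    have e2 : dworkCoeff L 2 γ 2 = 2 ^ 2 := by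
      simp [dworkCoeff, Finset.sum_range_succ, Nat.factorial, hγ2]
      field_simp
      norm_num
    have e3 : dworkCoeff L 2 γ 3 = -2 ^ 4 / 3 := by
      simp [dworkCoeff, Finset.sum_range_succ, Nat.factorial, hγ2]
      field_simp
      norm_num
    have e4 : dworkCoeff L 2 γ 4 = 2 ^ 2 * 5 / 3 := by
      simp [dworkCoeff, Finset.sum_range_succ, Nat.factorial, hγ2]
      field_simp
      norm_num
    rw [hγ2, norm_neg, n2, ← hγ2]
    interval_cases n
    · rw [e2, norm_pow, n2]; norm_num
    · rw [e3, norm_div, norm_neg, norm_pow, n2, n3]; norm_num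
    · rw [e4, norm_div, norm_mul, norm_pow, n2, n3, n5]; norm_num
  · rcases lt_or_ge n p with hnp | hnp
    · rw [norm_dworkCoeff_of_lt hnorm hnp]
      exact pow_lt_self_of_lt_one₀ hγ0 hγ1 hn2
    · have hp3 : 3 ≤ p := by have := hp.out.two_le; omega
      refine (norm_dworkCoeff_le hnorm hγ hγr hr n).trans_lt
        ((pow_le_pow_of_le_one hr0 hr1.le hnp).trans_lt
          (pow_lt_norm_of_sq_lt (p := p) hγ0 hγ1 hr0 hr ?_))
      obtain ⟨q, rfl⟩ := Nat.exists_eq_add_of_le hp3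
      rw [show 3 + q - 1 = 2 + q by omega]
      nlinarith [Nat.zero_le (q ^ 3)]

end dwork

/-- For every unit `u` (i.e. `‖u‖ = 1`), one has `‖E_γ(u) − 1‖ = p^(−1/(p−1))`; in a
`p`-adic field containing `γ` and `u`, this says `E_γ(u) − 1` is a uniformising
parameter. -/
theorem dworkSeries_sub_one_norm
    (p : ℕ) [Fact p.Prime] (L : Type*) [NormedField L] [CompleteSpace L]
    [Algebra ℚ_[p] L] (hnorm : ∀ q : ℚ_[p], ‖algebraMap ℚ_[p] L q‖ = ‖q‖)
    (γ : L) (hγ : γ ^ (p - 1) = -(p : L))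
    (u : L) (hu : ‖u‖ = 1) :
    ‖(∑' n : ℕ, dworkCoeff L p γ n * u ^ n) - 1‖
      = (p : ℝ) ^ (-(1 : ℝ) / ((p : ℝ) - 1)) := by
  have hp : p.Prime := Fact.out
  have := isUltrametricDist_of_norm_algebraMap hnorm
  have hγ0 := norm_pos_of_pow_eq_neg_prime hnorm hγ
  have hγ1 := norm_lt_one_of_pow_eq_neg_prime hnorm hγ
  have hp2 : p ^ 2 ≠ 0 := pow_ne_zero 2 hp.ne_zero
  obtain ⟨r, hr0, hr⟩ : ∃ r : ℝ, 0 ≤ r ∧ r ^ (p ^ 2) = ‖γ‖ ^ ((p - 1) ^ 2) :=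
    ⟨(‖γ‖ ^ ((p - 1) ^ 2)) ^ (((p ^ 2 : ℕ) : ℝ)⁻¹), by positivity,
      Real.rpow_inv_natCast_pow (by positivity) hp2⟩
  have hγr : ‖γ‖ ≤ r := by
    rw [← pow_le_pow_iff_left₀ hγ0.le hr0 hp2, hr]
    exact pow_le_pow_of_le_one hγ0.le hγ1.le (Nat.pow_le_pow_left (Nat.sub_le p 1) 2)
  have hr1 : r < 1 := by
    rw [← pow_lt_one_iff_of_nonneg hr0 hp2, hr]
    exact pow_lt_one₀ hγ0.le hγ1 (pow_ne_zero 2 (Nat.sub_ne_zero_of_lt hp.one_lt))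
  have hterm (n : ℕ) : ‖dworkCoeff L p γ n * u ^ n‖ = ‖dworkCoeff L p γ n‖ := by
    rw [norm_mul, norm_pow, hu, one_pow, mul_one]
  have hle (n : ℕ) : ‖dworkCoeff L p γ n * u ^ n‖ ≤ r ^ n :=
    (hterm n).trans_le (norm_dworkCoeff_le hnorm hγ hγr hr n)
  have hsum : Summable fun n => dworkCoeff L p γ n * u ^ n :=
    Summable.of_norm_bounded (summable_geometric_of_lt_one hr0 hr1) hle
  have htail : ‖∑' n, dworkCoeff L p γ (n + 5) * u ^ (n + 5)‖ < ‖γ‖ := by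
    refine (IsUltrametricDist.norm_tsum_le_of_forall_le_of_nonneg (pow_nonneg hr0 5) fun n =>
      (hle (n + 5)).trans (pow_le_pow_of_le_one hr0 hr1.le (by omega))).trans_lt
        (pow_lt_norm_of_sq_lt (p := p) hγ0 hγ1 hr0 hr ?_)
    obtain ⟨q, rfl⟩ := Nat.exists_eq_add_of_le hp.two_le
    rw [show 2 + q - 1 = 1 + q by omega]
    have h : (1 + q) ^ 2 * 5 = (2 + q) ^ 2 + (4 * q ^ 2 + 6 * q + 1) := by ring
    omega
  have hsmall (n : ℕ) (hn2 : 2 ≤ n) (hn5 : n < 5) : ‖dworkCoeff L p γ n * u ^ n‖ < ‖γ‖ :=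
    (hterm n).trans_lt (norm_dworkCoeff_lt_of_lt_five hnorm hγ hγr hr1 hr hn2 hn5)
  have hlin : ‖dworkCoeff L p γ 1 * u ^ 1‖ = ‖γ‖ := by
    rw [hterm, norm_dworkCoeff_of_lt hnorm hp.one_lt, pow_one]
  have hdecomp : (∑' n, dworkCoeff L p γ n * u ^ n) - 1 = dworkCoeff L p γ 1 * u ^ 1 +
      (dworkCoeff L p γ 2 * u ^ 2 + dworkCoeff L p γ 3 * u ^ 3 + dworkCoeff L p γ 4 * u ^ 4 +
        ∑' n, dworkCoeff L p γ (n + 5) * u ^ (n + 5)) := by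
    rw [← hsum.sum_add_tsum_nat_add 5]
    simp only [Finset.sum_range_succ, Finset.sum_range_zero, dworkCoeff_zero]
    ring
  have hrest : ‖dworkCoeff L p γ 2 * u ^ 2 + dworkCoeff L p γ 3 * u ^ 3 +
      dworkCoeff L p γ 4 * u ^ 4 + ∑' n, dworkCoeff L p γ (n + 5) * u ^ (n + 5)‖ < ‖γ‖ := by
    have hadd {x y : L} (hx : ‖x‖ < ‖γ‖) (hy : ‖y‖ < ‖γ‖) : ‖x + y‖ < ‖γ‖ :=
      (IsUltrametricDist.norm_add_le_max x y).trans_lt (max_lt hx hy)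
    exact hadd (hadd (hadd (hsmall 2 le_rfl (by norm_num)) (hsmall 3 (by norm_num) (by norm_num)))
      (hsmall 4 (by norm_num) (by norm_num))) htail
  rw [hdecomp, IsUltrametricDist.norm_add_eq_max_of_norm_ne_norm (by rw [hlin]; exact hrest.ne'),
    hlin, max_eq_left hrest.le]
  exact norm_eq_rpow_of_pow_eq_neg_prime hnorm hγ
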